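/- arXiv:2509.05177 — 2 statements merged into one kernel-verified Lean document; each statement's English description precedes it below -/
import Mathlib

section
/- Let f : [0,1]^J → ℝ be continuous, let 𝔏 be a finite family of distinct nonempty subsets of 𝐉 = {1,…,J} that contains the full set l̃ = 𝐉, and let (c_l)_{l∈𝔏} be nonzero real coefficients. Define G(q) = ∑_{l∈𝔏} c_l ∫_{A_l(q)} f(v) dv for q ∈ [0,1]^J. Then for every q ∈ (0,1)^J the mixed partial derivative ∂^J G/∂q_1⋯∂q_J, taken once with respect to each coordinate, exists and equals c_{l̃} f(q); equivalently, f(q) = (1/c_{l̃}) ∂^J G/∂q_1⋯∂q_J (q), so the integrand f is recovered everywhere on (0,1)^J from G. -/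
open MeasureTheory

/-- `HasPartialDerivAt G j q v`: the partial derivative of `G : ℝ^J → ℝ` with respect to
the `j`-th coordinate exists at the point `q` and equals `v`. -/
def HasPartialDerivAt {J : ℕ} (G : (Fin J → ℝ) → ℝ) (j : Fin J)
    (q : Fin J → ℝ) (v : ℝ) : Prop :=
  HasDerivAt (fun t : ℝ => G (Function.update q j t)) v (q j)

/-- `HasMixedPartialOn S G L h`: on the set `S`, the iterated partial derivatives of `G`
taken successively once with respect to each coordinate in the list `L` exist, and the
resulting function coincides with `h` on `S`. -/
def HasMixedPartialOn {J : ℕ} (S : Set (Fin J → ℝ)) :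
    ((Fin J → ℝ) → ℝ) → List (Fin J) → ((Fin J → ℝ) → ℝ) → Prop
  | G, [], h => ∀ q ∈ S, G q = h q
  | G, j :: L, h => ∃ G' : (Fin J → ℝ) → ℝ,
      (∀ q ∈ S, HasPartialDerivAt G j q (G' q)) ∧ HasMixedPartialOn S G' L h

/-- `α_l(q)`: the corner with `α_l(q)_j = q_j` for `j ∈ l` and `= 1` for `j ∉ l`. -/
def alphaCorner {J : ℕ} (l : Finset (Fin J)) (q : Fin J → ℝ) : Fin J → ℝ :=
  fun j => if j ∈ l then q j else 1

open Set Function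

/-- Resampling the coordinate `j` of a product measure: if the `j`-th factor of `μ` is replaced by a
probability measure, then overwriting the `j`-th coordinate with a sample of `μ j` recovers `μ`. -/
theorem map_update_prod_pi_update {ι : Type*} [Fintype ι] [DecidableEq ι] (μ ν : ι → Measure ℝ)
    [∀ i, SigmaFinite (μ i)] [∀ i, SigmaFinite (ν i)] (j : ι) [IsProbabilityMeasure (ν j)]
    (h : ∀ i, i ≠ j → ν i = μ i) :
    ((μ j).prod (Measure.pi ν)).map (fun p : ℝ × (ι → ℝ) => update p.2 j p.1) = Measure.pi μ := by
  symm
  refine Measure.pi_eq fun s hs => ?_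
  have hm : Measurable (fun p : ℝ × (ι → ℝ) => update p.2 j p.1) := by
    refine Continuous.measurable ?_
    fun_prop
  have hpre : (fun p : ℝ × (ι → ℝ) => update p.2 j p.1) ⁻¹' univ.pi s
      = s j ×ˢ univ.pi (update s j univ) := by
    ext p
    simp only [mem_preimage, mem_pi, mem_univ, true_implies, mem_prod]
    constructor
    · refine fun hp => ⟨by simpa using hp j, fun i => ?_⟩
      rcases eq_or_ne i j with rfl | hi
      · simp
      · simpa [hi] using hp i
    · rintro ⟨h1, h2⟩ i
      rcases eq_or_ne i j with rfl | hi
      · simpa using h1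
      · simpa [hi] using h2 i
  rw [Measure.map_apply hm (MeasurableSet.univ_pi hs), hpre, Measure.prod_prod, Measure.pi_pi,
    ← Finset.mul_prod_erase _ _ (Finset.mem_univ j),
    ← Finset.mul_prod_erase (a := j) _ _ (Finset.mem_univ j)]
  simp only [update_self, measure_univ, one_mul]
  congr 1
  refine Finset.prod_congr rfl fun i hi => ?_
  have hi' := Finset.ne_of_mem_erase hi
  rw [update_of_ne hi', h i hi']

theorem volume_restrict_Icc_pi {ι : Type*} [Fintype ι] (a b : ι → ℝ) :
    (volume : Measure (ι → ℝ)).restrict (Icc a b)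
      = Measure.pi fun i => (volume : Measure ℝ).restrict (Icc (a i) (b i)) := by
  rw [← pi_univ_Icc, volume_pi, Measure.restrict_pi_pi]

/-- Fubini on a box for one coordinate, the remaining box keeping its dimension by having the
unit interval as its `j`-th side. -/
theorem setIntegral_Icc_eq_intervalIntegral_update {ι : Type*} [Fintype ι] [DecidableEq ι]
    {g : (ι → ℝ) → ℝ} (hg : Continuous g) (b : ι → ℝ) (j : ι) (hb : 0 ≤ b j) :
    ∫ v in Icc 0 b, g v
      = ∫ x in (0 : ℝ)..b j, ∫ v in Icc 0 (update b j 1), g (update v j x) := by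
  have hu : Continuous (fun p : ℝ × (ι → ℝ) => update p.2 j p.1) := by fun_prop
  have : IsProbabilityMeasure
      ((volume : Measure ℝ).restrict (Icc ((0 : ι → ℝ) j) (update b j 1 j))) :=
    ⟨by simp⟩
  have hmap := map_update_prod_pi_update
    (fun i => (volume : Measure ℝ).restrict (Icc ((0 : ι → ℝ) i) (b i)))
    (fun i => (volume : Measure ℝ).restrict (Icc ((0 : ι → ℝ) i) (update b j 1 i))) j
    (fun i hi => by simp [hi])
  rw [← volume_restrict_Icc_pi, ← volume_restrict_Icc_pi] at hmap
  rw [← hmap, integral_map hu.aemeasurable hg.aestronglyMeasurable,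
    intervalIntegral.integral_of_le hb, ← integral_Icc_eq_integral_Ioc, integral_prod]
  · rfl
  · rw [Measure.prod_restrict]
    exact (hg.comp hu).continuousOn.integrableOn_compact (isCompact_Icc.prod isCompact_Icc)

/-- The partial integral of `g` in which the coordinates in `D` are frozen at `q`, those in `l \ D`
run over `[0, q i]`, and all others over `[0, 1]`. -/
noncomputable def partialBoxIntegral {J : ℕ} (g : (Fin J → ℝ) → ℝ) (D l : Finset (Fin J))
    (q : Fin J → ℝ) : ℝ :=
  ∫ v in Icc 0 (alphaCorner (l \ D) q), g (D.piecewise q v)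

theorem continuous_piecewise_pi {ι : Type*} [DecidableEq ι] (D : Finset ι) :
    Continuous fun p : (ι → ℝ) × (ι → ℝ) => D.piecewise p.1 p.2 := by
  refine continuous_pi fun i => ?_
  by_cases hi : i ∈ D <;> simp only [Finset.piecewise, hi, if_true, if_false] <;> fun_prop

section partialBoxIntegral

variable {J : ℕ} {g : (Fin J → ℝ) → ℝ} {D l : Finset (Fin J)} {j : Fin J}

theorem alphaCorner_sdiff_insert_update (q : Fin J → ℝ) (x : ℝ) :
    alphaCorner (l \ insert j D) (update q j x) = alphaCorner (l \ insert j D) q := by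
  ext i
  rcases eq_or_ne i j with rfl | hi <;> simp [alphaCorner, *]

theorem partialBoxIntegral_update_eq_intervalIntegral (hg : Continuous g) (hjD : j ∉ D)
    (hjl : j ∈ l) (q : Fin J → ℝ) {t : ℝ} (ht : 0 ≤ t) :
    partialBoxIntegral g D l (update q j t)
      = ∫ x in (0 : ℝ)..t, partialBoxIntegral g (insert j D) l (update q j x) := by
  have hbj : alphaCorner (l \ D) (update q j t) j = t := by simp [alphaCorner, hjD, hjl]
  have hcorner : update (alphaCorner (l \ D) (update q j t)) j 1
      = alphaCorner (l \ insert j D) q := by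
    ext i
    rcases eq_or_ne i j with rfl | hi <;> simp [alphaCorner, *]
  have hcont : Continuous fun v => g (D.piecewise (update q j t) v) :=
    hg.comp ((continuous_piecewise_pi D).comp (by fun_prop :
      Continuous fun v : Fin J → ℝ => (update q j t, v)))
  rw [partialBoxIntegral, setIntegral_Icc_eq_intervalIntegral_update hcont _ j (by rwa [hbj]),
    hbj, hcorner]
  simp only [partialBoxIntegral, alphaCorner_sdiff_insert_update]
  have hpt (x : ℝ) (v : Fin J → ℝ) : D.piecewise (update q j t) (update v j x)
      = (insert j D).piecewise (update q j x) v := by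
    ext i
    rcases eq_or_ne i j with rfl | hi <;> simp [Finset.piecewise, *]
  simp only [hpt]

theorem continuous_partialBoxIntegral_insert_update (hg : Continuous g) (q : Fin J → ℝ) :
    Continuous fun x => partialBoxIntegral g (insert j D) l (update q j x) := by
  simp only [partialBoxIntegral, alphaCorner_sdiff_insert_update]
  refine continuous_parametric_integral_of_continuous
    (f := fun x v => g ((insert j D).piecewise (update q j x) v)) ?_ isCompact_Icc
  exact hg.comp ((continuous_piecewise_pi _).comp (by fun_prop :
    Continuous fun p : ℝ × (Fin J → ℝ) => (update q j p.1, p.2)))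

theorem hasPartialDerivAt_partialBoxIntegral (hg : Continuous g) (hjD : j ∉ D) (hjl : j ∈ l)
    {q : Fin J → ℝ} (hq : 0 < q j) :
    HasPartialDerivAt (partialBoxIntegral g D l) j q (partialBoxIntegral g (insert j D) l q) := by
  have hK := continuous_partialBoxIntegral_insert_update (D := D) (l := l) (j := j) hg q
  have hd := hK.integral_hasStrictDerivAt 0 (q j) |>.hasDerivAt
  rw [update_eq_self] at hd
  refine hd.congr_of_eventuallyEq ?_
  filter_upwards [Ioi_mem_nhds hq] with t ht
  exact partialBoxIntegral_update_eq_intervalIntegral hg hjD hjl q (le_of_lt ht)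

theorem hasPartialDerivAt_partialBoxIntegral_of_notMem (hjD : j ∉ D) (hjl : j ∉ l)
    (q : Fin J → ℝ) : HasPartialDerivAt (partialBoxIntegral g D l) j q 0 := by
  have hconst (t : ℝ) : partialBoxIntegral g D l (update q j t) = partialBoxIntegral g D l q := by
    have hcorner : alphaCorner (l \ D) (update q j t) = alphaCorner (l \ D) q := by
      ext i
      rcases eq_or_ne i j with rfl | hi <;> simp [alphaCorner, *]
    have hpt (v : Fin J → ℝ) : D.piecewise (update q j t) v = D.piecewise q v := by
      ext i
      rcases eq_or_ne i j with rfl | hi <;> simp [Finset.piecewise, *]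
    simp only [partialBoxIntegral, hcorner, hpt]
  simp only [HasPartialDerivAt, hconst]
  exact hasDerivAt_const _ _

theorem partialBoxIntegral_univ (q : Fin J → ℝ) :
    partialBoxIntegral g Finset.univ l q = g q := by
  have hcorner : alphaCorner (l \ Finset.univ) q = 1 := by
    ext i
    simp [alphaCorner]
  simp [partialBoxIntegral, hcorner, measureReal_def, Real.volume_Icc_pi]

theorem hasPartialDerivAt_sum_partialBoxIntegral (hg : Continuous g) (𝔏 : Finset (Finset (Fin J)))
    (c : Finset (Fin J) → ℝ) (hjD : j ∉ D) {q : Fin J → ℝ} (hq : 0 < q j) :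
    HasPartialDerivAt (fun p => ∑ l ∈ 𝔏 with D ⊆ l, c l * partialBoxIntegral g D l p) j q
      (∑ l ∈ 𝔏 with insert j D ⊆ l, c l * partialBoxIntegral g (insert j D) l q) := by
  have hsum : ∑ l ∈ 𝔏 with insert j D ⊆ l, c l * partialBoxIntegral g (insert j D) l q
      = ∑ l ∈ 𝔏 with D ⊆ l,
          c l * if j ∈ l then partialBoxIntegral g (insert j D) l q else 0 := by
    simp only [mul_ite, mul_zero, ← Finset.sum_filter, Finset.filter_filter,
      Finset.insert_subset_iff, and_comm]
  rw [hsum]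
  refine HasDerivAt.fun_sum fun l _ => HasDerivAt.const_mul _ ?_
  split_ifs with hjl
  · exact hasPartialDerivAt_partialBoxIntegral hg hjD hjl hq
  · exact hasPartialDerivAt_partialBoxIntegral_of_notMem hjD hjl q

theorem hasMixedPartialOn_of_eqOn_sum_partialBoxIntegral (hg : Continuous g)
    {𝔏 : Finset (Finset (Fin J))} (hfull : Finset.univ ∈ 𝔏) (c : Finset (Fin J) → ℝ)
    {S : Set (Fin J → ℝ)} (hS : IsOpen S) (hpos : ∀ q ∈ S, ∀ i, 0 < q i) {h : (Fin J → ℝ) → ℝ}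
    (hh : EqOn h (fun q => c Finset.univ * g q) S)
    {L : List (Fin J)} (hL : L.Nodup) (hLD : ∀ i, i ∈ L ↔ i ∉ D) {G : (Fin J → ℝ) → ℝ}
    (hG : EqOn G (fun q => ∑ l ∈ 𝔏 with D ⊆ l, c l * partialBoxIntegral g D l q) S) :
    HasMixedPartialOn S G L h := by
  induction L generalizing D G with
  | nil =>
    intro q hq
    obtain rfl : D = Finset.univ := Finset.eq_univ_iff_forall.2 fun i => by simpa using hLD i
    have hfilter : 𝔏.filter (Finset.univ ⊆ ·) = {Finset.univ} := by
      ext l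
      simp only [Finset.univ_subset_iff, Finset.mem_filter, Finset.mem_singleton]
      exact ⟨And.right, fun hl => ⟨hl ▸ hfull, hl⟩⟩
    simp only [hG hq, hh hq, hfilter, Finset.sum_singleton, partialBoxIntegral_univ]
  | cons j L ih =>
    have hjD : j ∉ D := (hLD j).1 List.mem_cons_self
    refine ⟨_, fun q hq => ?_, ih (D := insert j D) hL.of_cons (fun i => ?_) fun q _ => rfl⟩
    · refine (hasPartialDerivAt_sum_partialBoxIntegral hg 𝔏 c hjD (hpos q hq j))
        |>.congr_of_eventuallyEq ?_
      have hcont : Continuous fun t : ℝ => update q j t := by fun_prop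
      have hmem : ∀ᶠ t in nhds (q j), update q j t ∈ S :=
        hcont.continuousAt.eventually_mem (hS.mem_nhds (by rwa [update_eq_self]))
      filter_upwards [hmem] with t ht using hG ht
    · have hi := hLD i
      have hjL := (List.nodup_cons.1 hL).1
      rcases eq_or_ne i j with rfl | hij
      · simp [hjL]
      · simpa [hij] using hi

end partialBoxIntegral

theorem exists_continuous_eqOn_Icc {ι : Type*} {f : (ι → ℝ) → ℝ}
    (hf : ContinuousOn f (Icc 0 1)) : ∃ g : (ι → ℝ) → ℝ, Continuous g ∧ EqOn g f (Icc 0 1) := by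
  refine ⟨fun v => f (0 ⊔ (1 ⊓ v)), hf.comp_continuous
    (continuous_pi fun i => continuous_const.sup (continuous_const.inf (continuous_apply i)))
      fun v => ?_, fun v hv => ?_⟩
  · exact ⟨le_sup_left, sup_le zero_le_one inf_le_left⟩
  · simp only [inf_eq_right.2 hv.2, sup_eq_right.2 hv.1]

/-- with `G(q) = ∑_{l∈𝔏} c_l ∫_{A_l(q)} f(v) dv` over a family `𝔏` of
distinct nonempty subsets of `𝐉` containing the full set `l̃ = 𝐉` and with nonzero
coefficients, the mixed partial `∂^J G/∂q_1⋯∂q_J` exists on `(0,1)^J` and equals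
`c_{l̃} f(q)`; hence `f` is recovered on `(0,1)^J` from `G`. -/
theorem mixed_partial_full_rank_recovers_integrand (J : ℕ) (hJ : 1 ≤ J)
    (f : (Fin J → ℝ) → ℝ) (hf : ContinuousOn f (Set.Icc 0 1))
    (𝔏 : Finset (Finset (Fin J))) (h𝔏 : ∀ l ∈ 𝔏, l.Nonempty)
    (hfull : (Finset.univ : Finset (Fin J)) ∈ 𝔏)
    (c : Finset (Fin J) → ℝ) (hc : ∀ l ∈ 𝔏, c l ≠ 0)
    (G : (Fin J → ℝ) → ℝ)
    (hG : ∀ q : Fin J → ℝ,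
      G q = ∑ l ∈ 𝔏, c l * ∫ v in Set.Icc (0 : Fin J → ℝ) (alphaCorner l q), f v) :
    HasMixedPartialOn (Set.univ.pi fun _ : Fin J => Set.Ioo (0 : ℝ) 1)
      G (List.finRange J) (fun q => c (Finset.univ : Finset (Fin J)) * f q) := by
  obtain ⟨g, hg, hgf⟩ := exists_continuous_eqOn_Icc hf
  have hS : ∀ q ∈ Set.univ.pi fun _ : Fin J => Set.Ioo (0 : ℝ) 1, ∀ i, 0 < q i ∧ q i < 1 :=
    fun q hq i => hq i trivial
  refine hasMixedPartialOn_of_eqOn_sum_partialBoxIntegral (D := ∅) hg hfull c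
    (isOpen_set_pi finite_univ fun _ _ => isOpen_Ioo) (fun q hq i => (hS q hq i).1)
    (fun q hq => ?_) (List.nodup_finRange J) (by simp) (fun q hq => ?_)
  · simp only [hgf ⟨fun i => (hS q hq i).1.le, fun i => (hS q hq i).2.le⟩]
  · simp only [hG, Finset.empty_subset, Finset.filter_true, partialBoxIntegral, Finset.sdiff_empty,
      Finset.piecewise_empty]
    refine Finset.sum_congr rfl fun l _ => ?_
    congr 1
    refine setIntegral_congr_fun measurableSet_Icc fun v hv => (hgf ⟨hv.1, hv.2.trans ?_⟩).symm
    intro i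
    by_cases hi : i ∈ l <;> simp [alphaCorner, hi, (hS q hq i).2.le]
end

section
/- Let f : [0,1]^J → ℝ be continuous, let 𝔏 be a finite family of distinct nonempty subsets of 𝐉 = {1,…,J} with nonzero real coefficients (c_l)_{l∈𝔏}, and let l̂ ∈ 𝔏 be a leading term of 𝔏 (no l' ∈ 𝔏 with l' ≠ l̂ satisfies l̂ ⊆ l'). Define G(q) = ∑_{l∈𝔏} c_l ∫_{A_l(q)} f(v) dv. Then for every q ∈ (0,1)^J, the mixed partial derivative of G taken once with respect to each coordinate q_j with j ∈ l̂ exists and equals c_{l̂} ∫_{[0,1]^{𝐉∖l̂}} f(ρ(q,w)) dw, where ρ(q,w) ∈ [0,1]^J is defined by ρ(q,w)_j = q_j for j ∈ l̂ and ρ(q,w)_j = w_j for j ∉ l̂; that is, it equals c_{l̂} times the marginal of f over the coordinates in l̂, evaluated at (q_j)_{j∈l̂}. -/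
open MeasureTheory

/-- `ρ(q,w)`: the point with coordinates `q_j` for `j ∈ l` and `w_j` for `j ∉ l`. -/
def rho {J : ℕ} (l : Finset (Fin J)) (q w : Fin J → ℝ) : Fin J → ℝ :=
  fun j => if j ∈ l then q j else w j

open scoped Topology

theorem isOpen_openCube (J : ℕ) :
    IsOpen (Set.univ.pi fun _ : Fin J => Set.Ioo (0 : ℝ) 1) :=
  isOpen_set_pi Set.finite_univ fun _ _ => isOpen_Ioo

theorem HasMixedPartialOn.congr_right {J : ℕ} {S : Set (Fin J → ℝ)} {L : List (Fin J)} :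
    ∀ {G h h' : (Fin J → ℝ) → ℝ}, HasMixedPartialOn S G L h → (∀ q ∈ S, h q = h' q) →
      HasMixedPartialOn S G L h' := by
  induction L with
  | nil => exact fun hG hh q hq => (hG q hq).trans (hh q hq)
  | cons j L ih =>
    rintro G h h' ⟨G', hd, hG'⟩ hh
    exact ⟨G', hd, ih hG' hh⟩

theorem HasMixedPartialOn.congr_left {J : ℕ} {S : Set (Fin J → ℝ)} (hS : IsOpen S)
    {L : List (Fin J)} {G G₁ h : (Fin J → ℝ) → ℝ} (hG : HasMixedPartialOn S G L h)
    (hEq : ∀ q ∈ S, G₁ q = G q) : HasMixedPartialOn S G₁ L h := by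
  cases L with
  | nil => exact fun q hq => (hEq q hq).trans (hG q hq)
  | cons j L =>
    obtain ⟨G', hd, hG'⟩ := hG
    refine ⟨G', fun q hq => (hd q hq).congr_of_eventuallyEq ?_, hG'⟩
    have hc : ContinuousAt (fun t : ℝ => Function.update q j t) (q j) := by fun_prop
    have hmem : ∀ᶠ t in 𝓝 (q j), Function.update q j t ∈ S :=
      hc.eventually (hS.mem_nhds (by simpa using hq))
    filter_upwards [hmem] with t ht using hEq _ ht

theorem HasMixedPartialOn.sum_const_mul {J : ℕ} {S : Set (Fin J → ℝ)} {ι : Type*}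
    (s : Finset ι) (c : ι → ℝ) {L : List (Fin J)} :
    ∀ {G h : ι → (Fin J → ℝ) → ℝ}, (∀ i, HasMixedPartialOn S (G i) L (h i)) →
      HasMixedPartialOn S (fun q => ∑ i ∈ s, c i * G i q) L
        (fun q => ∑ i ∈ s, c i * h i q) := by
  induction L with
  | nil => exact fun hG q hq => Finset.sum_congr rfl fun i _ => by rw [hG i q hq]
  | cons j L ih =>
    intro G h hG
    choose G' hd hG' using hG
    exact ⟨fun q => ∑ i ∈ s, c i * G' i q,
      fun q hq => HasDerivAt.fun_sum fun i _ => (hd i q hq).const_mul (c i), ih hG'⟩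

theorem hasMixedPartialOn_zero {J : ℕ} (S : Set (Fin J → ℝ)) (L : List (Fin J)) :
    HasMixedPartialOn S (fun _ => 0) L (fun _ => 0) := by
  induction L with
  | nil => exact fun _ _ => rfl
  | cons j L ih => exact ⟨_, fun q _ => hasDerivAt_const (q j) (0 : ℝ), ih⟩

theorem measurePreserving_update {ι : Type*} [Fintype ι] [DecidableEq ι] {X : Type*}
    [MeasurableSpace X] (ν : Measure X) [IsProbabilityMeasure ν] (j : ι) :
    MeasurePreserving (fun p : X × (ι → X) => Function.update p.2 j p.1)
      (ν.prod (Measure.pi fun _ => ν)) (Measure.pi fun _ => ν) := by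
  have hm : Measurable (fun p : X × (ι → X) => Function.update p.2 j p.1) := by
    refine measurable_pi_lambda _ fun i => ?_
    by_cases h : i = j
    · subst h; simpa using measurable_fst
    · simpa [h, Function.comp_def] using (measurable_pi_apply i).comp measurable_snd
  refine ⟨hm, (Measure.pi_eq fun s hs => ?_).symm⟩
  rw [Measure.map_apply hm (MeasurableSet.univ_pi hs)]
  have hpre : (fun p : X × (ι → X) => Function.update p.2 j p.1) ⁻¹' Set.univ.pi s
      = s j ×ˢ Set.univ.pi (Function.update s j Set.univ) := by
    ext p
    simp only [Set.mem_preimage, Set.mem_univ_pi, Set.mem_prod]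
    constructor
    · intro h
      refine ⟨by simpa using h j, fun i => ?_⟩
      by_cases hi : i = j
      · subst hi; simp
      · simpa [hi] using h i
    · rintro ⟨h, h'⟩ i
      by_cases hi : i = j
      · subst hi; simpa using h
      · simpa [hi] using h' i
  rw [hpre, Measure.prod_prod, Measure.pi_pi, ← Finset.mul_prod_erase _ _ (Finset.mem_univ j),
    ← Finset.mul_prod_erase _ (fun i => ν (s i)) (Finset.mem_univ j)]
  simp only [Function.update_self, measure_univ, one_mul]
  congr 1
  refine Finset.prod_congr rfl fun i hi => ?_
  rw [Function.update_of_ne (Finset.ne_of_mem_erase hi)]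

/-- The uniform measure on the unit cube. -/
noncomputable def unitCubeMeasure (J : ℕ) : Measure (Fin J → ℝ) :=
  Measure.pi fun _ => (volume : Measure ℝ).restrict (Set.Icc 0 1)

instance isProbabilityMeasure_restrict_unitInterval :
    IsProbabilityMeasure ((volume : Measure ℝ).restrict (Set.Icc 0 1)) :=
  ⟨by simp⟩

instance (J : ℕ) : IsProbabilityMeasure (unitCubeMeasure J) := by
  unfold unitCubeMeasure; infer_instance

theorem unitCubeMeasure_eq_restrict (J : ℕ) :
    unitCubeMeasure J = volume.restrict (Set.Icc 0 1) := by
  rw [unitCubeMeasure, ← Measure.restrict_pi_pi, Set.pi_univ_Icc, volume_pi]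
  rfl

/-- The points whose coordinates in `A` are at most those of `q`. -/
def partialLowerSet {J : ℕ} (A : Finset (Fin J)) (q : Fin J → ℝ) : Set (Fin J → ℝ) :=
  {v | ∀ i ∈ A, v i ≤ q i}

theorem measurableSet_partialLowerSet {J : ℕ} (A : Finset (Fin J)) (q : Fin J → ℝ) :
    MeasurableSet (partialLowerSet A q) := by
  have : partialLowerSet A q = ⋂ i ∈ A, {v | v i ≤ q i} := by
    ext v; simp [partialLowerSet]
  rw [this]
  exact Finset.measurableSet_biInter _ fun i _ =>
    measurableSet_le (measurable_pi_apply i) measurable_const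

theorem continuous_rho {J : ℕ} (D : Finset (Fin J)) (q : Fin J → ℝ) :
    Continuous (rho D q) := by
  refine continuous_pi fun i => ?_
  unfold rho
  split_ifs <;> fun_prop

/-- The integral of `F` over the unit cube in which the coordinates in `D` are frozen at
those of `q` and the coordinates in `A` range below those of `q`. -/
noncomputable def partialMarginal {J : ℕ} (F : (Fin J → ℝ) → ℝ) (A D : Finset (Fin J))
    (q : Fin J → ℝ) : ℝ :=
  ∫ v in partialLowerSet A q, F (rho D q v) ∂unitCubeMeasure J

section

variable {J : ℕ} {F : (Fin J → ℝ) → ℝ} {C : ℝ} {A D : Finset (Fin J)} {j : Fin J}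

theorem continuous_integral_update (hF : Continuous F) (hC : ∀ v, ‖F v‖ ≤ C)
    (B : Set (Fin J → ℝ)) (q : Fin J → ℝ) :
    Continuous fun t : ℝ =>
      ∫ v in B, F (rho D q (Function.update v j t)) ∂unitCubeMeasure J := by
  refine continuous_of_dominated (bound := fun _ => C) (fun t => ?_)
    (fun t => ae_of_all _ fun v => hC _) (integrable_const _) (ae_of_all _ fun v => ?_)
  · have : Continuous fun v : Fin J → ℝ => F (rho D q (Function.update v j t)) :=
      hF.comp ((continuous_rho D q).comp (by fun_prop))
    exact this.aestronglyMeasurable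
  · exact hF.comp ((continuous_rho D q).comp (by fun_prop))

theorem rho_update_left (hD : j ∉ D) (q v : Fin J → ℝ) (s : ℝ) :
    rho D (Function.update q j s) v = rho D q v := by
  ext i
  unfold rho
  split_ifs with h
  · exact Function.update_of_ne (ne_of_mem_of_not_mem h hD) _ _
  · rfl

theorem rho_insert (D : Finset (Fin J)) (j : Fin J) (q v : Fin J → ℝ) :
    rho (insert j D) q v = rho D q (Function.update v j (q j)) := by
  ext i
  by_cases hi : i = j
  · subst hi; simp [rho]
  · simp [rho, hi]

theorem partialLowerSet_update_of_notMem (hA : j ∉ A) (q : Fin J → ℝ) (s : ℝ) :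
    partialLowerSet A (Function.update q j s) = partialLowerSet A q := by
  ext v
  refine forall₂_congr fun i hi => ?_
  rw [Function.update_of_ne (ne_of_mem_of_not_mem hi hA)]

theorem update_mem_partialLowerSet_update (hA : j ∈ A) (q v : Fin J → ℝ) (s t : ℝ) :
    Function.update v j t ∈ partialLowerSet A (Function.update q j s) ↔
      t ≤ s ∧ v ∈ partialLowerSet (A.erase j) q := by
  constructor
  · intro h
    refine ⟨by simpa using h j hA, fun i hi => ?_⟩
    have hij := Finset.ne_of_mem_erase hi
    simpa [hij] using h i (Finset.mem_of_mem_erase hi)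
  · rintro ⟨h, h'⟩ i hi
    by_cases hij : i = j
    · subst hij; simpa using h
    · simpa [hij] using h' i (Finset.mem_erase.2 ⟨hij, hi⟩)

theorem partialMarginal_update_eq_intervalIntegral (hF : Continuous F) (hC : ∀ v, ‖F v‖ ≤ C)
    (hA : j ∈ A) (hD : j ∉ D) (q : Fin J → ℝ) {s : ℝ} (hs : s ∈ Set.Icc (0 : ℝ) 1) :
    partialMarginal F A D (Function.update q j s) =
      ∫ t in (0 : ℝ)..s, ∫ v in partialLowerSet (A.erase j) q,
        F (rho D q (Function.update v j t)) ∂unitCubeMeasure J := by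
  set g : (Fin J → ℝ) → ℝ := (partialLowerSet A (Function.update q j s)).indicator
    fun v => F (rho D q v) with hg
  have hint : Integrable g (unitCubeMeasure J) := by
    refine Integrable.indicator ?_ (measurableSet_partialLowerSet _ _)
    exact Integrable.of_bound (hF.comp (continuous_rho D q)).aestronglyMeasurable C
      (ae_of_all _ fun v => hC _)
  have hmp := measurePreserving_update ((volume : Measure ℝ).restrict (Set.Icc 0 1)) j
  have hinner : ∀ t : ℝ, ∫ v, g (Function.update v j t) ∂unitCubeMeasure J =
      (Set.Iic s).indicator (fun t => ∫ v in partialLowerSet (A.erase j) q,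
        F (rho D q (Function.update v j t)) ∂unitCubeMeasure J) t := by
    intro t
    by_cases ht : t ≤ s
    · rw [Set.indicator_of_mem (by exact ht),
        ← integral_indicator (measurableSet_partialLowerSet _ _)]
      congr 1 with v
      by_cases hv : v ∈ partialLowerSet (A.erase j) q
      · rw [hg, Set.indicator_of_mem hv, Set.indicator_of_mem
          ((update_mem_partialLowerSet_update hA q v s t).2 ⟨ht, hv⟩)]
      · rw [hg, Set.indicator_of_notMem hv, Set.indicator_of_notMem
          fun h => hv ((update_mem_partialLowerSet_update hA q v s t).1 h).2]
    · rw [Set.indicator_of_notMem (by exact ht)]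
      refine integral_eq_zero_of_ae (ae_of_all _ fun v => ?_)
      exact Set.indicator_of_notMem
        (fun h => ht ((update_mem_partialLowerSet_update hA q v s t).1 h).1) _
  calc partialMarginal F A D (Function.update q j s)
      = ∫ v, g v ∂unitCubeMeasure J := by
        rw [hg, integral_indicator (measurableSet_partialLowerSet _ _), partialMarginal]
        simp only [rho_update_left hD]
    _ = ∫ p, g (Function.update p.2 j p.1)
          ∂((volume : Measure ℝ).restrict (Set.Icc 0 1)).prod (unitCubeMeasure J) := by
        have hmap := integral_map (f := g) hmp.measurable.aemeasurable
          (by rw [hmp.map_eq]; exact hint.aestronglyMeasurable)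
        rw [hmp.map_eq] at hmap
        exact hmap
    _ = ∫ t in Set.Icc (0 : ℝ) 1, ∫ v, g (Function.update v j t) ∂unitCubeMeasure J :=
        integral_prod _ (hmp.integrable_comp_of_integrable hint)
    _ = _ := by
        simp only [hinner]
        rw [setIntegral_indicator measurableSet_Iic, intervalIntegral.integral_of_le hs.1,
          ← integral_Icc_eq_integral_Ioc]
        congr 2
        ext t
        simp only [Set.mem_inter_iff, Set.mem_Icc, Set.mem_Iic]
        exact ⟨fun h => ⟨h.1.1, h.2⟩, fun h => ⟨⟨h.1, h.2.trans hs.2⟩, h.2⟩⟩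

theorem hasPartialDerivAt_partialMarginal (hF : Continuous F) (hC : ∀ v, ‖F v‖ ≤ C)
    (hA : j ∈ A) (hD : j ∉ D) {q : Fin J → ℝ} (hq : q j ∈ Set.Ioo (0 : ℝ) 1) :
    HasPartialDerivAt (partialMarginal F A D) j q
      (partialMarginal F (A.erase j) (insert j D) q) := by
  have hcont := continuous_integral_update (D := D) (j := j) hF hC
    (partialLowerSet (A.erase j) q) q
  have hderiv := intervalIntegral.integral_hasDerivAt_right
    (hcont.intervalIntegrable 0 (q j)) (hcont.stronglyMeasurableAtFilter _ _) hcont.continuousAt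
  have hval : partialMarginal F (A.erase j) (insert j D) q =
      ∫ v in partialLowerSet (A.erase j) q,
        F (rho D q (Function.update v j (q j))) ∂unitCubeMeasure J := by
    simp only [partialMarginal, rho_insert]
  rw [hval]
  refine hderiv.congr_of_eventuallyEq ?_
  filter_upwards [isOpen_Ioo.mem_nhds hq] with s hs using
    partialMarginal_update_eq_intervalIntegral hF hC hA hD q (Set.Ioo_subset_Icc_self hs)

theorem hasPartialDerivAt_partialMarginal_of_notMem (F : (Fin J → ℝ) → ℝ)
    (hA : j ∉ A) (hD : j ∉ D) (q : Fin J → ℝ) :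
    HasPartialDerivAt (partialMarginal F A D) j q 0 := by
  have : (fun t : ℝ => partialMarginal F A D (Function.update q j t)) =
      fun _ => partialMarginal F A D q := by
    ext t
    simp only [partialMarginal, partialLowerSet_update_of_notMem hA, rho_update_left hD]
  unfold HasPartialDerivAt
  rw [this]
  exact hasDerivAt_const _ _

theorem hasMixedPartialOn_partialMarginal (hF : Continuous F) (hC : ∀ v, ‖F v‖ ≤ C)
    {L : List (Fin J)} (hL : L.Nodup) :
    ∀ {A D : Finset (Fin J)}, (∀ i ∈ L, i ∉ D) →
      HasMixedPartialOn (Set.univ.pi fun _ : Fin J => Set.Ioo (0 : ℝ) 1)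
        (partialMarginal F A D) L
        (fun q => if L.toFinset ⊆ A then
          partialMarginal F (A \ L.toFinset) (D ∪ L.toFinset) q else 0) := by
  induction L with
  | nil => intro A D _ q _; simp
  | cons j L ih =>
    intro A D hD
    obtain ⟨hjL, hL⟩ := List.nodup_cons.1 hL
    have hjD : j ∉ D := hD j List.mem_cons_self
    by_cases hA : j ∈ A
    · refine ⟨partialMarginal F (A.erase j) (insert j D), fun q hq =>
        hasPartialDerivAt_partialMarginal hF hC hA hjD (hq j trivial), ?_⟩
      refine (ih hL fun i hi hiD => ?_).congr_right fun q _ => ?_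
      · rcases Finset.mem_insert.1 hiD with rfl | h
        · exact hjL hi
        · exact hD i (List.mem_cons_of_mem _ hi) h
      · have h₁ : L.toFinset ⊆ A.erase j ↔ (j :: L).toFinset ⊆ A := by
          rw [Finset.subset_erase, List.toFinset_cons, Finset.insert_subset_iff]
          simp [hA, hjL]
        have h₂ : A.erase j \ L.toFinset = A \ (j :: L).toFinset := by
          ext i; simp; tauto
        have h₃ : insert j D ∪ L.toFinset = D ∪ (j :: L).toFinset := by
          ext i; simp
        simp only [h₁, h₂, h₃]
    · refine ⟨fun _ => 0, fun q _ =>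
        hasPartialDerivAt_partialMarginal_of_notMem F hA hjD q, ?_⟩
      refine (hasMixedPartialOn_zero _ L).congr_right fun q _ => ?_
      rw [if_neg]
      exact fun h => hA (h (by simp))

end

theorem exists_continuous_bounded_extension {J : ℕ} {f : (Fin J → ℝ) → ℝ}
    (hf : ContinuousOn f (Set.Icc 0 1)) :
    ∃ (F : (Fin J → ℝ) → ℝ) (C : ℝ), Continuous F ∧ (∀ v, ‖F v‖ ≤ C) ∧
      Set.EqOn F f (Set.Icc 0 1) := by
  obtain ⟨C, hC⟩ := isCompact_Icc.exists_bound_of_continuousOn hf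
  have hmem : ∀ v : Fin J → ℝ, (0 ⊔ (1 ⊓ v) : Fin J → ℝ) ∈ Set.Icc (0 : Fin J → ℝ) 1 :=
    fun v => ⟨le_sup_left, sup_le zero_le_one inf_le_left⟩
  have hcont : Continuous fun v : Fin J → ℝ => (0 ⊔ (1 ⊓ v) : Fin J → ℝ) :=
    continuous_pi fun i => continuous_const.max (continuous_const.min (continuous_apply i))
  refine ⟨fun v => f (0 ⊔ (1 ⊓ v)), C, hf.comp_continuous hcont hmem,
    fun v => hC _ (hmem v), fun v hv => ?_⟩
  simp only [inf_eq_right.2 hv.2, sup_eq_right.2 hv.1]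

theorem setIntegral_alphaCorner_eq_partialMarginal {J : ℕ} {f F : (Fin J → ℝ) → ℝ}
    (hFf : Set.EqOn F f (Set.Icc 0 1)) (l : Finset (Fin J)) {q : Fin J → ℝ}
    (hq : q ∈ Set.univ.pi fun _ : Fin J => Set.Ioo (0 : ℝ) 1) :
    ∫ v in Set.Icc (0 : Fin J → ℝ) (alphaCorner l q), f v = partialMarginal F l ∅ q := by
  have hset : Set.Icc (0 : Fin J → ℝ) (alphaCorner l q) =
      partialLowerSet l q ∩ Set.Icc 0 1 := by
    ext v
    simp only [Set.mem_Icc, Set.mem_inter_iff, partialLowerSet, Set.mem_ofPred_eq, Pi.le_def,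
      alphaCorner]
    constructor
    · rintro ⟨h0, h1⟩
      refine ⟨fun i hi => by simpa [hi] using h1 i, h0, fun i => (h1 i).trans ?_⟩
      split_ifs
      · exact (hq i trivial).2.le
      · exact le_rfl
    · rintro ⟨h, h0, h1⟩
      refine ⟨h0, fun i => ?_⟩
      split_ifs with hi
      · exact h i hi
      · exact h1 i
  have hrho : ∀ v, rho ∅ q v = v := fun v => by ext i; simp [rho]
  simp only [partialMarginal, hrho]
  rw [unitCubeMeasure_eq_restrict, Measure.restrict_restrict (measurableSet_partialLowerSet _ _),
    ← hset]
  refine setIntegral_congr_fun measurableSet_Icc fun v hv => (hFf ?_).symm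
  rw [hset] at hv
  exact hv.2

theorem partialMarginal_empty_eq_setIntegral {J : ℕ} {f F : (Fin J → ℝ) → ℝ}
    (hFf : Set.EqOn F f (Set.Icc 0 1)) (D : Finset (Fin J)) {q : Fin J → ℝ}
    (hq : q ∈ Set.univ.pi fun _ : Fin J => Set.Ioo (0 : ℝ) 1) :
    partialMarginal F ∅ D q = ∫ w in Set.Icc (0 : Fin J → ℝ) 1, f (rho D q w) := by
  have hset : partialLowerSet ∅ q = Set.univ := by ext v; simp [partialLowerSet]
  rw [partialMarginal, hset, Measure.restrict_univ, unitCubeMeasure_eq_restrict]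
  refine setIntegral_congr_fun measurableSet_Icc fun w hw => hFf ?_
  have hbound : ∀ i, rho D q w i ∈ Set.Icc (0 : ℝ) 1 := fun i => by
    unfold rho
    split_ifs
    · exact Set.Ioo_subset_Icc_self (hq i trivial)
    · exact ⟨hw.1 i, hw.2 i⟩
  exact ⟨fun i => (hbound i).1, fun i => (hbound i).2⟩

/-- with `G(q) = ∑_{l∈𝔏} c_l ∫_{A_l(q)} f(v) dv` and `lhat ∈ 𝔏` a leading
term of `𝔏`, the mixed partial derivative of `G` taken once with respect to each
coordinate `q_j`, `j ∈ lhat`, exists on `(0,1)^J` and equals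
`c_{lhat} ∫_{[0,1]^{𝐉∖lhat}} f(ρ(q,w)) dw`, i.e. `c_{lhat}` times the marginal of `f` over the
coordinates in `lhat` evaluated at `(q_j)_{j∈lhat}`.  (Integrating `ρ(q,·)` over the full
cube `[0,1]^J` integrates out exactly the coordinates outside `lhat`.) -/
theorem mixed_partial_leading_term_marginal (J : ℕ) (hJ : 1 ≤ J)
    (f : (Fin J → ℝ) → ℝ) (hf : ContinuousOn f (Set.Icc 0 1))
    (𝔏 : Finset (Finset (Fin J))) (h𝔏 : ∀ l ∈ 𝔏, l.Nonempty)
    (c : Finset (Fin J) → ℝ) (hc : ∀ l ∈ 𝔏, c l ≠ 0)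
    (lhat : Finset (Fin J)) (hlhat : lhat ∈ 𝔏)
    (hlead : ∀ l' ∈ 𝔏, l' ≠ lhat → ¬ lhat ⊆ l')
    (G : (Fin J → ℝ) → ℝ)
    (hG : ∀ q : Fin J → ℝ,
      G q = ∑ l ∈ 𝔏, c l * ∫ v in Set.Icc (0 : Fin J → ℝ) (alphaCorner l q), f v) :
    HasMixedPartialOn (Set.univ.pi fun _ : Fin J => Set.Ioo (0 : ℝ) 1)
      G (lhat.sort (· ≤ ·))
      (fun q => c lhat * ∫ w in Set.Icc (0 : Fin J → ℝ) 1, f (rho lhat q w)) := by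
  obtain ⟨F, C, hF, hC, hFf⟩ := exists_continuous_bounded_extension hf
  have hsum := HasMixedPartialOn.sum_const_mul 𝔏 c fun l =>
    hasMixedPartialOn_partialMarginal hF hC (A := l) (D := ∅)
      (lhat.sort_nodup (· ≤ ·)) (by simp)
  refine (hsum.congr_left (isOpen_openCube J) fun q hq => ?_).congr_right fun q hq => ?_
  · rw [hG]
    exact Finset.sum_congr rfl fun l _ => by
      rw [setIntegral_alphaCorner_eq_partialMarginal hFf l hq]
  · simp only [Finset.sort_toFinset]
    rw [Finset.sum_eq_single_of_mem lhat hlhat fun l hl hne => by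
      rw [if_neg (hlead l hl hne), mul_zero]]
    rw [if_pos subset_rfl, sdiff_self, Finset.empty_union]
    exact congrArg _ (partialMarginal_empty_eq_setIntegral hFf lhat hq)
end
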